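/- Suppose the HNN-extension 𝔼 = ⟨B, t; t⁻¹Ht = K, φ⟩ satisfies condition (*) and 𝒞 is a root class of groups. Then: (1) if 𝔙 ∈ 𝒞, then for each subgroup R ∈ 𝒞*(L) there exists a subgroup S ∈ 𝒞*(L) with S ≤ R such that S𝔳 = S for every automorphism 𝔳 ∈ 𝔙; (2) if 𝔘 ∈ 𝒞, then for each subgroup R ∈ 𝒞*(H) there exists a subgroup S ∈ 𝒞*(H) with S ≤ R such that S𝔲 = S for every automorphism 𝔲 ∈ 𝔘; (3) if 𝒞 consists only of periodic groups and N is a subgroup of B that is locally cyclic or 𝒞-bounded nilpotent, then for each subgroup R ∈ 𝒞*(N) there exists a subgroup S ∈ 𝒞*(N) with S ≤ R such that S𝔞 = S for every automorphism 𝔞 ∈ Aut(N). -/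

import Mathlib

universe u

open Subgroup

/-- A class of groups in universe `u`: a property of groups. -/
abbrev GroupClass : Type (u + 1) := (G : Type u) → [inst : Group G] → Prop

/-- The class is closed under isomorphism. -/
def IsoClosed (C : GroupClass.{u}) : Prop :=
  ∀ (G₁ G₂ : Type u) [Group G₁] [Group G₂], (G₁ ≃* G₂) → C G₁ → C G₂

/-- The class is closed under taking subgroups. -/
def SubgroupClosed (C : GroupClass.{u}) : Prop :=
  ∀ (G : Type u) [Group G] (H : Subgroup G), C G → C H

/-- The class is closed under taking quotient groups. -/
def QuotClosed (C : GroupClass.{u}) : Prop :=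
  ∀ (G : Type u) [Group G] (N : Subgroup G) [N.Normal], C G → C (G ⧸ N)

/-- The class is closed under direct products of a finite number of factors. -/
def FinProdClosed (C : GroupClass.{u}) : Prop :=
  ∀ (ι : Type u) [Finite ι] (G : ι → Type u) [∀ i, Group (G i)],
    (∀ i, C (G i)) → C (∀ i, G i)

/-- Gruenberg's condition. -/
def Gruenberg (C : GroupClass.{u}) : Prop :=
  ∀ (X : Type u) [Group X] (Y Z : Subgroup X) (_ : Z ≤ Y) (hY : Y.Normal)
    (hZY : (Z.subgroupOf Y).Normal), C (X ⧸ Y) → C (↥Y ⧸ Z.subgroupOf Y) →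
    ∃ T : Subgroup X, ∃ _ : T.Normal, T ≤ Z ∧ C (X ⧸ T)

/-- A root class of groups. -/
def IsRootClass (C : GroupClass.{u}) : Prop :=
  IsoClosed C ∧ (∃ (G : Type u) (_ : Group G), C G ∧ Nontrivial G) ∧
    SubgroupClosed C ∧ Gruenberg C

/-- `X` is residually a `C`-group. -/
def Residually (C : GroupClass.{u}) (X : Type u) [Group X] : Prop :=
  ∀ x : X, x ≠ 1 → ∃ (G : Type u) (_ : Group G) (f : X →* G),
    Function.Surjective f ∧ C G ∧ f x ≠ 1

/-- Every element has finite order. -/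
def Periodic (G : Type u) [Group G] : Prop := ∀ g : G, IsOfFinOrder g

/-- The class consists only of periodic groups. -/
def PeriodicClass (C : GroupClass.{u}) : Prop := ∀ (G : Type u) [Group G], C G → Periodic G

/-- `Aut_X(Y)`: the subgroup of `Aut(Y)` consisting of the restrictions to `Y`
of the inner automorphisms of `X` (that leave `Y` invariant; when `Y` is normal
in `X` these are the restrictions of all inner automorphisms of `X`). -/
def autOf (X : Type u) [Group X] (Y : Subgroup X) : Subgroup (MulAut Y) where
  carrier := { α | ∃ x : X, ∀ y : Y, ((α y : Y) : X) = x * y * x⁻¹ }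
  one_mem' := ⟨1, fun y => by simp⟩
  mul_mem' := by
    rintro α β ⟨a, ha⟩ ⟨b, hb⟩
    refine ⟨a * b, fun y => ?_⟩
    have h1 : ((α (β y) : Y) : X) = a * (β y) * a⁻¹ := ha (β y)
    have h2 : ((β y : Y) : X) = b * y * b⁻¹ := hb y
    show ((α (β y) : Y) : X) = _
    rw [h1, h2]; group
  inv_mem' := by
    rintro α ⟨a, ha⟩
    refine ⟨a⁻¹, fun y => ?_⟩
    have h : ((α (α⁻¹ y) : Y) : X) = a * (α⁻¹ y) * a⁻¹ := ha (α⁻¹ y)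
    rw [MulAut.apply_inv_self] at h
    rw [h]; group

/-- Conjugation of automorphism groups along an isomorphism `φ : H ≃* K`,
giving `φ ∘ α ∘ φ⁻¹ : Aut K →* Aut H`. -/
def autConjHom {H K : Type u} [Group H] [Group K] (φ : H ≃* K) : MulAut K →* MulAut H where
  toFun α := (φ.trans α).trans φ.symm
  map_one' := by ext x; simp
  map_mul' := fun α β => by
    ext x
    simp [MulAut.mul_apply, MulEquiv.trans_apply, MulEquiv.apply_symm_apply]

/-- `N ∈ 𝒞*(X)`: `N` is normal in `X` and `X/N ∈ 𝒞`. -/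
def inCStar (C : GroupClass.{u}) (X : Type u) [Group X] (N : Subgroup X) : Prop :=
  ∃ _ : N.Normal, C (X ⧸ N)

/-- `X` is `𝒞`-quasi-regular with respect to its subgroup `Y`. -/
def QuasiRegular (C : GroupClass.{u}) (X : Type u) [Group X] (Y : Subgroup X) : Prop :=
  ∀ M : Subgroup Y, inCStar C Y M → ∃ N : Subgroup X, inCStar C X N ∧ N.subgroupOf Y ≤ M

/-- `𝔓(𝒞)`: the set of primes dividing the order of some element of some `𝒞`-group. -/
def primesOf (C : GroupClass.{u}) : Set ℕ :=
  { p | p.Prime ∧ ∃ (Z : Type u) (_ : Group Z), C Z ∧ ∃ z : Z, p ∣ orderOf z }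

/-- `Y` is `𝔓(𝒞)′`-isolated in `X`. -/
def PIsolated (C : GroupClass.{u}) {X : Type u} [Group X] (Y : Subgroup X) : Prop :=
  ∀ (x : X) (q : ℕ), q.Prime → q ∉ primesOf C → x ^ q ∈ Y → x ∈ Y

/-- Every finitely generated subgroup is cyclic. -/
def LocallyCyclic (G : Type u) [Group G] : Prop :=
  ∀ S : Subgroup G, S.FG → IsCyclic S

/-- `A` is a `𝒞`-bounded abelian group. -/
def CBoundedAbelian (C : GroupClass.{u}) (A : Type u) [Group A] : Prop :=
  (∀ a b : A, a * b = b * a) ∧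
  ∀ (N : Subgroup A), ∀ _ : N.Normal, ∀ p ∈ primesOf C,
    (∃ m : ℕ, 0 < m ∧ ∀ x : A ⧸ N, (∃ n : ℕ, x ^ p ^ n = 1) → x ^ m = 1) ∧
    (∃ (Z : Type u) (_ : Group Z), C Z ∧
      Cardinal.mk {x : A ⧸ N // ∃ n : ℕ, x ^ p ^ n = 1} ≤ Cardinal.mk Z)

/-- `X` is a `𝒞`-bounded nilpotent group: it has a finite central series with
`𝒞`-bounded abelian factors. -/
def CBoundedNilpotent (C : GroupClass.{u}) (X : Type u) [Group X] : Prop :=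
  ∃ (n : ℕ) (S : ℕ → Subgroup X), S 0 = ⊥ ∧ S n = ⊤ ∧
    (∀ i < n, S i ≤ S (i + 1)) ∧ (∀ i < n, (S i).Normal) ∧
    (∀ i < n, ∀ x ∈ S (i + 1), ∀ g : X, g⁻¹ * x⁻¹ * g * x ∈ S i) ∧
    (∀ i < n, ∀ _ : ((S i).subgroupOf (S (i + 1))).Normal,
      CBoundedAbelian C (↥(S (i + 1)) ⧸ (S i).subgroupOf (S (i + 1))))

/-- `A` is a normal subgroup of `U` (as subgroups of a common group). -/
def NormalIn {G : Type u} [Group G] (A U : Subgroup G) : Prop := (A.subgroupOf U).Normal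

/-- `G` satisfies a non-trivial identity. -/
def SatisfiesNontrivialIdentity (G : Type u) [Group G] : Prop :=
  ∃ w : FreeGroup ℕ, w ≠ 1 ∧ ∀ f : FreeGroup ℕ →* G, f w = 1

section HNN

variable {B : Type u} [Group B] (H K : Subgroup B) (φ : H ≃* K)

/-- `𝔎 = φ ∘ Aut_B(K) ∘ φ⁻¹`, as a subgroup of `Aut(H)`. -/
def frakK : Subgroup (MulAut H) := (autOf B K).map (autConjHom φ)

/-- `𝔘 = ⟨𝔥, 𝔎⟩ ≤ Aut(H)`. -/
def frakU : Subgroup (MulAut H) := autOf B H ⊔ frakK H K φ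

/-- `𝔙 = ⟨𝔏, 𝔉⟩ ≤ Aut(L)`, where `ψ = φ|_L`. -/
def frakV (ψ : MulAut ↥(H ⊓ K)) : Subgroup (MulAut ↥(H ⊓ K)) :=
  autOf B (H ⊓ K) ⊔ Subgroup.zpowers ψ

/-- `ψ` is the restriction of `φ` to `L = H ⊓ K` (this encodes the
`φ`-invariance of `L` from condition (*)). -/
def IsRestrictionToL (ψ : MulAut ↥(H ⊓ K)) : Prop :=
  ∀ x : ↥(H ⊓ K), ((ψ x : ↥(H ⊓ K)) : B) = ((φ ⟨(x : B), x.2.1⟩ : K) : B)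

/-- `(H ⊓ K)φ = H ⊓ K` : the `φ`-invariance of `L` from condition (*). -/
def PhiInvL : Prop :=
  ((H ⊓ K).subgroupOf H).map φ.toMonoidHom = (H ⊓ K).subgroupOf K

end HNN

section HNNExtra

variable (C : GroupClass.{u}) {B : Type u} [Group B] (H K : Subgroup B) (φ : H ≃* K)

/-- Condition (†): at least one of `𝔥` and `𝔎` is normal in `𝔘`, or `𝔘 ∈ 𝒞`. -/
def CondDag : Prop :=
  NormalIn (autOf B H) (frakU H K φ) ∨ NormalIn (frakK H K φ) (frakU H K φ) ∨
    C ↥(frakU H K φ)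

/-- Condition (‡): at least one of `𝔏` and `𝔉` is normal in `𝔙`, or `𝔙 ∈ 𝒞`. -/
def CondDDag (ψ : MulAut ↥(H ⊓ K)) : Prop :=
  NormalIn (autOf B (H ⊓ K)) (frakV H K ψ) ∨
    NormalIn (Subgroup.zpowers ψ) (frakV H K ψ) ∨ C ↥(frakV H K ψ)

/-- `Q` is a pre-`𝒞`-admissible subgroup of `B`: it is normal, `(H,K,φ)`-compatible,
`B/Q ∈ 𝒞`, and `HQ/Q ∩ KQ/Q = LQ/Q`. -/
def PreAdmissible (Q : Subgroup B) : Prop :=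
  ∃ _ : Q.Normal, ((Q ⊓ H).subgroupOf H).map φ.toMonoidHom = (Q ⊓ K).subgroupOf K ∧
    C (B ⧸ Q) ∧
    (H.map (QuotientGroup.mk' Q)) ⊓ (K.map (QuotientGroup.mk' Q)) =
      (H ⊓ K).map (QuotientGroup.mk' Q)

end HNNExtra

section RootClass

variable {C : GroupClass.{u}}

theorem IsRootClass.of_injective (hC : IsRootClass C) {X Y : Type u} [Group X] [Group Y]
    (f : X →* Y) (hf : Function.Injective f) (hY : C Y) : C X :=
  hC.1 _ _ (MonoidHom.ofInjective hf).symm (hC.2.2.1 Y f.range hY)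

theorem IsRootClass.of_subsingleton (hC : IsRootClass C) (X : Type u) [Group X]
    [Subsingleton X] : C X := by
  obtain ⟨G, _, hG, _⟩ := hC.2.1
  exact hC.of_injective (1 : X →* G) (Function.injective_of_subsingleton _) hG

theorem IsRootClass.of_extension (hC : IsRootClass C) {X : Type u} [Group X] (Y : Subgroup X)
    [hY : Y.Normal] (hCY : C Y) (hCQ : C (X ⧸ Y)) : C X := by
  have hb : ((⊥ : Subgroup X).subgroupOf Y) = ⊥ := by simp
  have hn : ((⊥ : Subgroup X).subgroupOf Y).Normal := inferInstance
  have hq : C (↥Y ⧸ (⊥ : Subgroup X).subgroupOf Y) :=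
    hC.1 _ _ (QuotientGroup.quotientBot.symm.trans
      (QuotientGroup.quotientMulEquivOfEq hb.symm)) hCY
  obtain ⟨T, _, hT, hCT⟩ := hC.2.2.2 X Y ⊥ bot_le hY hn hCQ hq
  refine hC.of_injective (QuotientGroup.mk' T) ?_ hCT
  rw [← MonoidHom.ker_eq_bot_iff, QuotientGroup.ker_mk']
  exact le_bot_iff.mp hT

/-- If a `C`-group `V` acts on `X`, every member of `C*(X)` contains a `V`-invariant one. -/
theorem IsRootClass.exists_invariant (hC : IsRootClass C) {X V : Type u} [Group X] [Group V]
    (θ : V →* MulAut X) (hV : C V) (R : Subgroup X) (hR : inCStar C X R) :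
    ∃ S : Subgroup X, inCStar C X S ∧ S ≤ R ∧ ∀ v, ∀ x ∈ S, θ v x ∈ S := by
  obtain ⟨_, hCR⟩ := hR
  have hinj : Function.Injective (SemidirectProduct.inl : X →* X ⋊[θ] V) :=
    SemidirectProduct.inl_injective
  let Y : Subgroup (X ⋊[θ] V) := SemidirectProduct.inl.range
  let Z : Subgroup (X ⋊[θ] V) := R.map SemidirectProduct.inl
  have hYk : Y = SemidirectProduct.rightHom.ker := SemidirectProduct.range_inl_eq_ker_rightHom
  have hY : Y.Normal := hYk ▸ inferInstance
  let e : X ≃* Y := MonoidHom.ofInjective hinj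
  have heR : R.map e.toMonoidHom = Z.subgroupOf Y := by
    ext ⟨y, x, rfl⟩
    simp only [Subgroup.mem_map, Subgroup.mem_subgroupOf, Z]
    exact exists_congr fun x' => and_congr_right fun _ => Subtype.ext_iff
  have hZY : (Z.subgroupOf Y).Normal := by
    rw [← heR]
    exact Subgroup.Normal.map inferInstance _ e.surjective
  have hCX : C ((X ⋊[θ] V) ⧸ Y) :=
    hC.1 _ _ ((QuotientGroup.quotientKerEquivOfSurjective SemidirectProduct.rightHom
      SemidirectProduct.rightHom_surjective).symm.trans
      (QuotientGroup.quotientMulEquivOfEq hYk.symm)) hV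
  have hCY : C (↥Y ⧸ Z.subgroupOf Y) := hC.1 _ _ (QuotientGroup.congr R _ e heR) hCR
  obtain ⟨T, hT, hTZ, hCT⟩ := hC.2.2.2 _ Y Z (Subgroup.map_le_range _ _) hY hZY hCX hCY
  refine ⟨T.comap SemidirectProduct.inl, ⟨inferInstance, ?_⟩, ?_, ?_⟩
  · refine hC.of_injective
      (QuotientGroup.map _ T SemidirectProduct.inl le_rfl) ?_ hCT
    rw [injective_iff_map_eq_one]
    intro q
    induction q using QuotientGroup.induction_on with
    | H x =>
      intro hx
      rw [QuotientGroup.map_mk, QuotientGroup.eq_one_iff] at hx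
      exact (QuotientGroup.eq_one_iff x).mpr hx
  · intro x hx
    obtain ⟨r, hr, hrx⟩ := hTZ hx
    exact hinj hrx ▸ hr
  · intro v x hx
    rw [Subgroup.mem_comap, SemidirectProduct.inl_aut]
    simpa using hT.conj_mem _ hx (SemidirectProduct.inr v)

theorem map_eq_of_forall_map_le {X : Type u} [Group X] {V : Subgroup (MulAut X)}
    {S : Subgroup X} (h : ∀ v ∈ V, ∀ x ∈ S, v x ∈ S) (v : MulAut X) (hv : v ∈ V) :
    S.map (MulEquiv.toMonoidHom v) = S := by
  apply le_antisymm
  · rintro _ ⟨x, hx, rfl⟩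
    exact h v hv x hx
  · intro x hx
    exact ⟨v⁻¹ x, h _ (V.inv_mem hv) x hx, MulAut.apply_inv_self _ _ _⟩

theorem IsRootClass.exists_map_eq (hC : IsRootClass C) {X : Type u} [Group X]
    (V : Subgroup (MulAut X)) (hV : C V) (R : Subgroup X) (hR : inCStar C X R) :
    ∃ S : Subgroup X, inCStar C X S ∧ S ≤ R ∧
      ∀ v ∈ V, S.map (MulEquiv.toMonoidHom v) = S := by
  obtain ⟨S, hS, hSR, hinv⟩ := hC.exists_invariant V.subtype hV R hR
  exact ⟨S, hS, hSR, map_eq_of_forall_map_le fun v hv => hinv ⟨v, hv⟩⟩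

/-- The action of `Y` on the Cartesian power `Y → X` by right translation of the argument. -/
def translationHom (X Y : Type u) [Group X] [Group Y] : Y →* MulAut (Y → X) where
  toFun y :=
    { toFun := fun f z => f (z * y)
      invFun := fun f z => f (z * y⁻¹)
      left_inv := fun f => by ext z; simp
      right_inv := fun f => by ext z; simp
      map_mul' := fun f g => rfl }
  map_one' := by ext f z; simp
  map_mul' a b := by ext f z; simp [mul_assoc]

theorem IsRootClass.pi (hC : IsRootClass C) {X Y : Type u} [Group X] [Group Y]
    (hX : C X) (hY : C Y) : C (Y → X) := by
  let ev : (Y → X) →* X := Pi.evalMonoidHom _ 1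
  have hev : Function.Surjective ev := fun x => ⟨fun _ => x, rfl⟩
  obtain ⟨S, ⟨_, hCS⟩, hSR, hinv⟩ := hC.exists_invariant (translationHom X Y) hY ev.ker
    ⟨inferInstance, hC.1 _ _ (QuotientGroup.quotientKerEquivOfSurjective ev hev).symm hX⟩
  refine hC.of_injective (QuotientGroup.mk' S) ?_ hCS
  rw [← MonoidHom.ker_eq_bot_iff, QuotientGroup.ker_mk', Subgroup.eq_bot_iff_forall]
  intro f hf
  ext y
  have h : f (1 * y) = 1 := hSR (hinv y f hf)
  simpa using h

theorem IsRootClass.exponentExists (hC : IsRootClass C) (hP : PeriodicClass C) {X : Type u}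
    [Group X] (hX : C X) : Monoid.ExponentExists X := by
  obtain ⟨n, hn, h⟩ := isOfFinOrder_iff_pow_eq_one.mp (hP _ (hC.pi hX hX) id)
  exact ⟨n, hn, fun x => congrFun h x⟩

theorem IsRootClass.zmod (hC : IsRootClass C) (hP : PeriodicClass C) {p : ℕ}
    (hp : p ∈ primesOf C) : C (ULift.{u} (Multiplicative (ZMod p))) := by
  obtain ⟨hpp, Z, _, hZ, z, hz⟩ := hp
  have hord : orderOf (z ^ (orderOf z / p)) = p :=
    orderOf_pow_orderOf_div (hP Z hZ z).orderOf_pos.ne' hz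
  have hcard : Nat.card (Subgroup.zpowers (z ^ (orderOf z / p))) = p := by
    rw [Nat.card_zpowers, hord]
  have e := zmodCyclicMulEquiv (G := Subgroup.zpowers (z ^ (orderOf z / p))) inferInstance
  rw [hcard] at e
  exact hC.1 _ _ (e.symm.trans MulEquiv.ulift.symm) (hC.2.2.1 Z _ hZ)

/-- A group of prime exponent `p ∈ 𝔓(C)` embedding as a set into a `C`-group is a `C`-group,
if it is commutative. -/
theorem IsRootClass.of_pow_prime_eq_one (hC : IsRootClass C) (hP : PeriodicClass C) {p : ℕ}
    (hp : p ∈ primesOf C) {D Z : Type u} [CommGroup D] [Group Z] (hZ : C Z)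
    (hD : ∀ d : D, d ^ p = 1) (hDZ : Cardinal.mk D ≤ Cardinal.mk Z) : C D := by
  have : Fact p.Prime := ⟨hp.1⟩
  let _ : Module (ZMod p) (Additive D) := AddCommGroup.zmodModule (n := p) fun d => hD d.toMul
  let b := Module.Basis.ofVectorSpace (ZMod p) (Additive D)
  let ι := Module.Basis.ofVectorSpaceIndex (ZMod p) (Additive D)
  obtain ⟨j⟩ := hDZ
  let k : ι → Z := fun i => j (i : Additive D).toMul
  have hk : Function.Injective k := fun i i' h => Subtype.ext (j.injective h)
  let f : D →* (ι → ULift.{u} (Multiplicative (ZMod p))) :=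
    { toFun := fun d i => ULift.up (Multiplicative.ofAdd (b.repr (Additive.ofMul d) i))
      map_one' := by ext i; simp
      map_mul' := fun x y => by ext i; simp }
  have hf : Function.Injective f := by
    intro x y h
    have h' : b.repr (Additive.ofMul x) = b.repr (Additive.ofMul y) := by
      ext i
      exact congrArg (fun u => u.down.toAdd) (congrFun h i)
    exact Additive.ofMul.injective (b.repr.injective h')
  refine hC.of_injective
    ((Function.ExtendByOne.hom (ULift.{u} (Multiplicative (ZMod p))) k).comp f) ?_
    (hC.pi (hC.zmod hP hp) hZ)
  rw [MonoidHom.coe_comp]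
  refine Function.Injective.comp (fun x y h => ?_) hf
  funext i
  have := congrFun h (k i)
  simpa [Function.ExtendByOne.hom, hk.extend_apply] using this

theorem IsRootClass.of_surjective_of_cBoundedAbelian (hC : IsRootClass C) (hP : PeriodicClass C)
    {A : Type u} [Group A] (hA : CBoundedAbelian C A) (m : ℕ) (hm : m ≠ 0)
    (hprime : ∀ p : ℕ, p.Prime → p ∣ m → p ∈ primesOf C) :
    ∀ (D : Type u) [Group D] (f : A →* D), Function.Surjective f → (∀ d : D, d ^ m = 1) →
      C D := by
  induction m using Nat.recOnMul with
  | zero => exact absurd rfl hm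
  | one =>
    intro D _ f _ hD
    have : Subsingleton D := ⟨fun a b => by rw [← pow_one a, ← pow_one b, hD, hD]⟩
    exact hC.of_subsingleton D
  | prime p hp =>
    intro D _ f hf hD
    let _ : CommGroup D :=
      { ‹Group D› with
        mul_comm := fun a b => by
          obtain ⟨a, rfl⟩ := hf a
          obtain ⟨b, rfl⟩ := hf b
          rw [← map_mul, hA.1, map_mul] }
    have hpC := hprime p hp dvd_rfl
    obtain ⟨-, Z, _, hZ, hle⟩ := hA.2 f.ker inferInstance p hpC
    refine hC.of_pow_prime_eq_one hP hpC hZ hD (le_trans ?_ hle)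
    let e := QuotientGroup.quotientKerEquivOfSurjective f hf
    refine Cardinal.mk_le_of_injective (f := fun d => ⟨e.symm d, 1, ?_⟩) ?_
    · rw [pow_one, ← map_pow, hD, map_one]
    · intro x y h
      exact e.symm.injective (congrArg Subtype.val h)
  | mul a b iha ihb =>
    intro D _ f hf hD
    let _ : CommGroup D :=
      { ‹Group D› with
        mul_comm := fun a b => by
          obtain ⟨a, rfl⟩ := hf a
          obtain ⟨b, rfl⟩ := hf b
          rw [← map_mul, hA.1, map_mul] }
    let g : D →* D := powMonoidHom a
    refine hC.of_extension g.range ?_ ?_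
    · refine ihb (right_ne_zero_of_mul hm) (fun p hp h => hprime p hp (h.mul_left a)) _
        (g.rangeRestrict.comp f) (g.rangeRestrict_surjective.comp hf) ?_
      rintro ⟨_, d, rfl⟩
      ext
      simp [g, ← pow_mul, hD]
    · refine iha (left_ne_zero_of_mul hm) (fun p hp h => hprime p hp (h.mul_right b)) _
        ((QuotientGroup.mk' g.range).comp f) ((QuotientGroup.mk'_surjective _).comp hf) ?_
      intro q
      induction q using QuotientGroup.induction_on with
      | H x => exact (QuotientGroup.eq_one_iff _).mpr ⟨x, rfl⟩

theorem IsRootClass.of_surjective_of_cBoundedNilpotent (hC : IsRootClass C)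
    (hP : PeriodicClass C) {X : Type u} [Group X] (hX : CBoundedNilpotent C X) {m : ℕ}
    (hm : m ≠ 0) (hprime : ∀ p : ℕ, p.Prime → p ∣ m → p ∈ primesOf C) {Q : Type u} [Group Q]
    (f : X →* Q) (hf : Function.Surjective f) (hQ : ∀ q : Q, q ^ m = 1) : C Q := by
  obtain ⟨n, S, h0, hn, hle, hnormal, -, hbdd⟩ := hX
  have key : ∀ i ≤ n, C ((S i).map f) := by
    intro i
    induction i with
    | zero =>
      intro _
      rw [h0, Subgroup.map_bot]
      exact hC.of_subsingleton _
    | succ i ih =>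
      intro hi
      have hi' : i < n := hi
      have := hnormal i hi'
      have hT : ((S i).map f).Normal := Subgroup.Normal.map inferInstance f hf
      refine hC.of_extension (((S i).map f).subgroupOf ((S (i + 1)).map f)) ?_ ?_
      · exact hC.1 _ _ (Subgroup.subgroupOfEquivOfLe (Subgroup.map_mono (hle i hi'))).symm
          (ih hi'.le)
      · refine hC.of_surjective_of_cBoundedAbelian hP (hbdd i hi' inferInstance) m hm hprime _
          (QuotientGroup.map _ _ (f.subgroupMap (S (i + 1))) ?_) ?_ ?_
        · intro x hx
          exact Subgroup.mem_map_of_mem f hx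
        · exact QuotientGroup.map_surjective_of_surjective _ _ _ ((QuotientGroup.mk'_surjective _).comp
            (f.subgroupMap_surjective _)) _
        · intro q
          induction q using QuotientGroup.induction_on with
          | H x =>
            rw [← QuotientGroup.mk_pow]
            have : x ^ m = 1 := Subtype.ext (hQ x)
            rw [this, QuotientGroup.mk_one]
  have h := key n le_rfl
  rw [hn, Subgroup.map_top_of_surjective f hf] at h
  exact hC.1 _ _ Subgroup.topEquiv h

theorem LocallyCyclic.exists_zpow {X : Type u} [Group X] (hX : LocallyCyclic X) (x y : X) :
    ∃ z : X, ∃ k l : ℤ, z ^ k = x ∧ z ^ l = y := by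
  obtain ⟨⟨z, hz⟩, h⟩ := hX (Subgroup.closure {x, y}) 
    ((Subgroup.fg_iff _).mpr ⟨{x, y}, rfl, Set.toFinite _⟩)
  obtain ⟨k, hk⟩ := h ⟨x, Subgroup.subset_closure (by simp)⟩
  obtain ⟨l, hl⟩ := h ⟨y, Subgroup.subset_closure (by simp)⟩
  exact ⟨z, k, l, congrArg Subtype.val hk, congrArg Subtype.val hl⟩

theorem LocallyCyclic.mem_iff_exists_pow {X : Type u} [Group X] (hX : LocallyCyclic X)
    (R : Subgroup X) [R.Normal] (hR : Monoid.ExponentExists (X ⧸ R)) (x : X) :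
    x ∈ R ↔ ∃ z : X, z ^ Monoid.exponent (X ⧸ R) = x := by
  constructor
  · intro hx
    let _ : CommGroup (X ⧸ R) :=
      { (inferInstance : Group (X ⧸ R)) with
        mul_comm := fun a b => by
          induction a using QuotientGroup.induction_on with
          | H a =>
          induction b using QuotientGroup.induction_on with
          | H b =>
          obtain ⟨z, k, l, rfl, rfl⟩ := hX.exists_zpow a b
          rw [← QuotientGroup.mk_mul, ← QuotientGroup.mk_mul, ← zpow_add, ← zpow_add,
            add_comm] }
    obtain ⟨q, hq⟩ := Monoid.exists_orderOf_eq_exponent hR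
    induction q using QuotientGroup.induction_on with
    | H y =>
    obtain ⟨z, k, l, rfl, rfl⟩ := hX.exists_zpow x y
    have hz : orderOf (z : X ⧸ R) = Monoid.exponent (X ⧸ R) := by
      refine Nat.dvd_antisymm (Monoid.order_dvd_exponent _) ?_
      rw [← hq, QuotientGroup.mk_zpow]
      exact orderOf_dvd_of_mem_zpowers ⟨l, rfl⟩
    have hk : ((orderOf (z : X ⧸ R) : ℕ) : ℤ) ∣ k := by
      rw [orderOf_dvd_iff_zpow_eq_one, ← QuotientGroup.mk_zpow, QuotientGroup.eq_one_iff]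
      exact hx
    obtain ⟨c, rfl⟩ := hk
    refine ⟨z ^ c, ?_⟩
    rw [← hz, ← zpow_natCast, ← zpow_mul, mul_comm]
  · rintro ⟨z, rfl⟩
    rw [← QuotientGroup.eq_one_iff, QuotientGroup.mk_pow, Monoid.pow_exponent_eq_one]

theorem IsRootClass.exists_characteristic (hC : IsRootClass C) (hP : PeriodicClass C)
    {X : Type u} [Group X] (hX : LocallyCyclic X ∨ CBoundedNilpotent C X) (R : Subgroup X)
    (hR : inCStar C X R) :
    ∃ S : Subgroup X, inCStar C X S ∧ S ≤ R ∧
      ∀ a : MulAut X, S.map (MulEquiv.toMonoidHom a) = S := by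
  obtain ⟨hRn, hCR⟩ := hR
  have hexp := hC.exponentExists hP hCR
  rcases hX with hX | hX
  · refine ⟨R, ⟨hRn, hCR⟩, le_rfl, fun a => map_eq_of_forall_map_le (V := ⊤) ?_ a trivial⟩
    intro v _ x hx
    rw [hX.mem_iff_exists_pow R hexp] at hx ⊢
    obtain ⟨z, rfl⟩ := hx
    exact ⟨v z, (map_pow v z _).symm⟩
  · set m := Monoid.exponent (X ⧸ R) with hm
    have hm0 : m ≠ 0 := Monoid.exponent_ne_zero.mpr hexp
    let S : Subgroup X := Subgroup.closure (Set.range fun x : X => x ^ m)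
    have hSinv : ∀ a : MulAut X, S.map (MulEquiv.toMonoidHom a) = S := by
      refine fun a => map_eq_of_forall_map_le (V := ⊤) ?_ a trivial
      intro v _ x hx
      have : S ≤ S.comap (MulEquiv.toMonoidHom v) := by
        rw [Subgroup.closure_le]
        rintro _ ⟨y, rfl⟩
        exact Subgroup.subset_closure ⟨v y, (map_pow v y _).symm⟩
      exact this hx
    have hSn : S.Normal := by
      refine ⟨fun x hx g => ?_⟩
      rw [← hSinv (MulAut.conj g)]
      exact ⟨x, hx, rfl⟩
    have hSR : S ≤ R := by
      rw [Subgroup.closure_le]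
      rintro _ ⟨y, rfl⟩
      show y ^ m ∈ R
      rw [← QuotientGroup.eq_one_iff, QuotientGroup.mk_pow, Monoid.pow_exponent_eq_one]
    refine ⟨S, ⟨hSn, ?_⟩, hSR, hSinv⟩
    refine hC.of_surjective_of_cBoundedNilpotent hP hX hm0 ?_ (QuotientGroup.mk' S)
      (QuotientGroup.mk'_surjective S) ?_
    · intro p hp hpm
      obtain ⟨g, hg⟩ := hp.exists_orderOf_eq_pow_factorization_exponent (X ⧸ R)
      refine ⟨hp, X ⧸ R, inferInstance, hCR, g, ?_⟩
      rw [hg]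
      exact dvd_pow_self p (hp.factorization_pos_of_dvd hm0 hpm).ne'
    · intro q
      induction q using QuotientGroup.induction_on with
      | H x => exact (QuotientGroup.eq_one_iff _).mpr (Subgroup.subset_closure ⟨x, rfl⟩)

end RootClass

theorem statement_15 (C : GroupClass.{u}) (hroot : IsRootClass C)
    {B : Type u} [Group B] (H K : Subgroup B) (φ : H ≃* K)
    (hH : H.Normal) (hK : K.Normal)
    (ψ : MulAut ↥(H ⊓ K)) (hψ : IsRestrictionToL H K φ ψ) :
    (C ↥(frakV H K ψ) → ∀ R : Subgroup ↥(H ⊓ K), inCStar C ↥(H ⊓ K) R →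
      ∃ S : Subgroup ↥(H ⊓ K), inCStar C ↥(H ⊓ K) S ∧ S ≤ R ∧
        ∀ v ∈ frakV H K ψ, S.map (MulEquiv.toMonoidHom v) = S) ∧
    (C ↥(frakU H K φ) → ∀ R : Subgroup ↥H, inCStar C ↥H R →
      ∃ S : Subgroup ↥H, inCStar C ↥H S ∧ S ≤ R ∧
        ∀ u ∈ frakU H K φ, S.map (MulEquiv.toMonoidHom u) = S) ∧
    (PeriodicClass C → ∀ N : Subgroup B,
      (LocallyCyclic N ∨ CBoundedNilpotent C N) →
      ∀ R : Subgroup ↥N, inCStar C ↥N R →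
        ∃ S : Subgroup ↥N, inCStar C ↥N S ∧ S ≤ R ∧
          ∀ a : MulAut ↥N, S.map (MulEquiv.toMonoidHom a) = S) := by
  exact ⟨fun hV R hR => hroot.exists_map_eq _ hV R hR,
    fun hU R hR => hroot.exists_map_eq _ hU R hR,
    fun hP N hN R hR => hroot.exists_characteristic hP hN R hR⟩
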